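/- arXiv:1207.2368 — 3 statements merged into one kernel-verified Lean document; each statement's English description precedes it below -/
import Mathlib

section
/- For all positive integers n and d with n < d < 2n, one has Σ_{j=0}^{⌊(d-1)/2⌋} ((2^{2n-2j} - 1) B_{2n-2j} / (2^{2d-1} d)) · C(2d-2j-2, d-1) · C(2n, 2j) = 0, where C(a,b) denotes the binomial coefficient (so in particular C(2n,2j) = 0 whenever 2j > 2n). -/
open scoped BigOperators

open Polynomial in
/-- A rational polynomial with period `1` is constant. -/
theorem polynomial_eq_C_of_eval_one_add (p : ℚ[X])
    (h : ∀ x : ℚ, p.eval (1 + x) = p.eval x) : p = C (p.eval 0) := by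
  have hnat : ∀ k : ℕ, p.eval (k : ℚ) = p.eval 0 := by
    intro k
    induction k with
    | zero => simp
    | succ k ih => rw [Nat.cast_succ, add_comm, h, ih]
  refine Polynomial.eq_of_infinite_eval_eq _ _ ?_
  refine (Set.infinite_range_of_injective (Nat.cast_injective (R := ℚ))).mono ?_
  rintro _ ⟨k, rfl⟩
  simp [hnat]

open Polynomial in
/-- The duplication formula for Bernoulli polynomials. -/
theorem bernoulli_comp_half_add_comp_half (n : ℕ) :
    C (2 ^ n) * ((Polynomial.bernoulli n).comp (C 2⁻¹ * X) +
      (Polynomial.bernoulli n).comp (C 2⁻¹ * (1 + X))) = 2 * Polynomial.bernoulli n := by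
  set D : ℕ → ℚ[X] := fun n => C (2 ^ n) * ((Polynomial.bernoulli n).comp (C 2⁻¹ * X) +
      (Polynomial.bernoulli n).comp (C 2⁻¹ * (1 + X))) - 2 * Polynomial.bernoulli n with hD
  have hconst : D (n + 1) = C ((D (n + 1)).eval 0) := by
    apply polynomial_eq_C_of_eval_one_add
    intro x
    have hx : (2⁻¹ : ℚ) * (1 + (1 + x)) = 1 + 2⁻¹ * x := by ring
    simp only [hD, eval_sub, eval_mul, eval_add, eval_comp, eval_C, eval_X, eval_one, eval_ofNat,
      hx, Polynomial.bernoulli_eval_one_add, Nat.add_sub_cancel, mul_pow, inv_pow]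
    field_simp
    ring
  have hder : derivative (D (n + 1)) = C (n + 1 : ℚ) * D n := by
    have h2 : (C (2 ^ (n + 1)) : ℚ[X]) * C 2⁻¹ = C (2 ^ n) := by
      rw [← C_mul]; congr 1; rw [pow_succ, mul_assoc, mul_inv_cancel₀ two_ne_zero, mul_one]
    have h3 : (C (n + 1 : ℚ) : ℚ[X]) = (n : ℚ[X]) + 1 := by simp
    simp only [hD, derivative_sub, derivative_mul, derivative_add, derivative_comp, derivative_C,
      derivative_X, derivative_one, derivative_ofNat, Polynomial.derivative_bernoulli_add_one,
      add_comp, mul_comp, natCast_comp, one_comp, h3, ← h2]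
    ring
  rw [hconst, derivative_C] at hder
  have hn : (C (n + 1 : ℚ) : ℚ[X]) ≠ 0 := by
    rw [Ne, C_eq_zero]; positivity
  exact sub_eq_zero.1 ((mul_eq_zero.1 hder.symm).resolve_left hn)

open Polynomial in
/-- The polynomial `∑ i, (2 ^ (n - i) - 1) B_{n - i} C(n, i) X ^ i`. -/
noncomputable def genocchiPolynomial (n : ℕ) : ℚ[X] :=
  C (2 ^ n) * (Polynomial.bernoulli n).comp (C 2⁻¹ * X) - Polynomial.bernoulli n

theorem genocchiPolynomial_coeff {n i : ℕ} (hi : i ≤ n) :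
    (genocchiPolynomial n).coeff i = (2 ^ (n - i) - 1) * bernoulli (n - i) * n.choose i := by
  have h : (2 : ℚ) ^ n = 2 ^ (n - i) * 2 ^ i := by rw [← pow_add, Nat.sub_add_cancel hi]
  rw [genocchiPolynomial, Polynomial.coeff_sub, Polynomial.coeff_C_mul,
    Polynomial.comp_C_mul_X_coeff, Polynomial.coeff_bernoulli, if_pos hi, h, inv_pow]
  field_simp

theorem genocchiPolynomial_coeff_of_lt {n i : ℕ} (hi : n < i) :
    (genocchiPolynomial n).coeff i = 0 := by
  rw [genocchiPolynomial, Polynomial.coeff_sub, Polynomial.coeff_C_mul,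
    Polynomial.comp_C_mul_X_coeff, Polynomial.coeff_bernoulli, if_neg (by omega)]
  simp

theorem genocchiPolynomial_natDegree_lt {n : ℕ} (hn : 0 < n) :
    (genocchiPolynomial n).natDegree < n := by
  rw [Nat.lt_iff_le_pred hn, Polynomial.natDegree_le_iff_coeff_eq_zero]
  intro i hi
  obtain rfl | h : i = n ∨ n < i := by omega
  · simp [genocchiPolynomial_coeff]
  · exact genocchiPolynomial_coeff_of_lt h

open Polynomial in
theorem genocchiPolynomial_comp_one_sub_X {n : ℕ} (hn : Even n) :
    (genocchiPolynomial n).comp (1 - X) = -genocchiPolynomial n := by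
  have hdup := bernoulli_comp_half_add_comp_half n
  have hrefl := Polynomial.bernoulli_comp_one_sub_X n
  rw [hn.neg_one_pow, one_mul] at hrefl
  have hhalf : (Polynomial.bernoulli n).comp (C 2⁻¹ * (1 - X)) =
      (Polynomial.bernoulli n).comp (C 2⁻¹ * (1 + X)) := by
    conv_lhs => rw [← hrefl]
    rw [comp_assoc]
    congr 1
    have h1 : (1 : ℚ[X]) = C 2⁻¹ * 2 := by
      rw [show (2 : ℚ[X]) = C 2 from rfl, ← C_mul, inv_mul_cancel₀ two_ne_zero, C_1]
    simp only [sub_comp, one_comp, X_comp]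
    linear_combination h1
  simp only [genocchiPolynomial, sub_comp, mul_comp, C_comp, comp_assoc, X_comp, hrefl, hhalf]
  linear_combination hdup

open Polynomial in
/-- The `i`-th iterated difference of a binomial coefficient. -/
theorem sum_neg_one_pow_mul_choose_mul_choose {N i : ℕ} (r : ℕ) (hi : i ≤ N) :
    ∑ l ∈ Finset.range (i + 1), (-1 : ℚ) ^ l * i.choose l * (N - l).choose r =
      if i ≤ r then ((N - i).choose (r - i) : ℚ) else 0 := by
  have h : ∑ l ∈ Finset.range (i + 1),
      C ((-1 : ℚ) ^ l * i.choose l) * (X + 1) ^ (N - l) = (X + 1) ^ (N - i) * X ^ i := by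
    have hX : (X : ℚ[X]) ^ i = (-1 + (X + 1)) ^ i := by congr 1; ring
    rw [hX, add_pow (-1 : ℚ[X]) (X + 1) i, Finset.mul_sum]
    refine Finset.sum_congr rfl fun l hl => ?_
    have hl' : l ≤ i := Nat.lt_succ_iff.1 (Finset.mem_range.1 hl)
    rw [show N - l = (N - i) + (i - l) by omega, pow_add]
    simp only [map_mul, map_pow, map_neg, map_one, map_natCast]
    ring
  have := congrArg (fun p => p.coeff r) h
  simpa only [finsetSum_coeff, coeff_C_mul, coeff_X_add_one_pow, coeff_mul_X_pow'] using this

open Polynomial in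
/-- The linear functional taking `X ^ i` to `C(2r - i, r)`. -/
noncomputable def centralChooseFunctional (r : ℕ) : ℚ[X] →ₗ[ℚ] ℚ :=
  Polynomial.lsum fun i => LinearMap.mulRight ℚ ((2 * r - i).choose r : ℚ)

open Polynomial in
theorem centralChooseFunctional_apply (r : ℕ) (p : ℚ[X]) {N : ℕ} (hN : p.natDegree < N) :
    centralChooseFunctional r p = ∑ i ∈ Finset.range N, p.coeff i * (2 * r - i).choose r := by
  rw [centralChooseFunctional, Polynomial.lsum_apply, Polynomial.sum_over_range' _ _ N hN]
  · simp
  · simp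

open Polynomial in
theorem centralChooseFunctional_comp_one_sub_X (r : ℕ) (p : ℚ[X]) (hp : p.natDegree ≤ 2 * r) :
    centralChooseFunctional r (p.comp (1 - X)) = centralChooseFunctional r p := by
  have hpow : ∀ i ≤ 2 * r, centralChooseFunctional r ((1 - X) ^ i) =
      ((2 * r - i).choose r : ℚ) := by
    intro i hi
    have hdeg : ((1 - X : ℚ[X]) ^ i).natDegree < i + 1 := by
      have h1 : (1 - X : ℚ[X]).natDegree ≤ 1 := by compute_degree
      have := natDegree_pow_le_of_le i h1
      omega
    have hcoeff : ∀ l, ((1 - X : ℚ[X]) ^ i).coeff l = (-1) ^ l * i.choose l := by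
      intro l
      have : (1 - X : ℚ[X]) ^ i = ((1 + X) ^ i).comp (C (-1) * X) := by
        simp [sub_eq_add_neg]
      rw [this, comp_C_mul_X_coeff, coeff_one_add_X_pow, mul_comm]
    rw [centralChooseFunctional_apply r _ hdeg]
    simp only [hcoeff]
    rw [sum_neg_one_pow_mul_choose_mul_choose r hi]
    split_ifs with h
    · rw [← Nat.choose_symm (show r ≤ 2 * r - i by omega)]
      congr 2
      omega
    · rw [Nat.choose_eq_zero_of_lt (by omega), Nat.cast_zero]
  rw [centralChooseFunctional_apply r p (Nat.lt_succ_of_le hp), comp,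
    eval₂_eq_sum_range' _ (Nat.lt_succ_of_le hp), map_sum]
  refine Finset.sum_congr rfl fun i hi => ?_
  rw [← smul_eq_C_mul, map_smul, hpow i (Nat.lt_succ_iff.1 (Finset.mem_range.1 hi)), smul_eq_mul]

/-- Vanishing of the Bernoulli-number sum for `n < d < 2n`
(Theorem 3.1, second identity, first case). -/
theorem bernoulli_sum_vanishes (n d : ℕ) (hn : 1 ≤ n) (hnd : n < d) (hd2n : d < 2 * n) :
    ∑ j ∈ Finset.range ((d - 1) / 2 + 1),
        ((2 ^ (2 * n - 2 * j) - 1) * bernoulli (2 * n - 2 * j) / (2 ^ (2 * d - 1) * d)) *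
          ((2 * d - 2 * j - 2).choose (d - 1)) * ((2 * n).choose (2 * j))
      = 0 := by
  have hdeg := genocchiPolynomial_natDegree_lt (n := 2 * n) (by omega)
  have hL : centralChooseFunctional (d - 1) (genocchiPolynomial (2 * n)) = 0 := by
    have h := centralChooseFunctional_comp_one_sub_X (d - 1) (genocchiPolynomial (2 * n)) (by omega)
    rw [genocchiPolynomial_comp_one_sub_X (even_two_mul n), map_neg] at h
    linarith
  rw [centralChooseFunctional_apply _ _ hdeg] at hL
  have hsum : ∑ j ∈ Finset.range ((d - 1) / 2 + 1), (genocchiPolynomial (2 * n)).coeff (2 * j) *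
      (2 * (d - 1) - 2 * j).choose (d - 1) = 0 := by
    rw [← hL, ← Finset.sum_image
      (f := fun i => (genocchiPolynomial (2 * n)).coeff i * ((2 * (d - 1) - i).choose (d - 1) : ℚ))
      (g := fun j : ℕ => 2 * j) (fun a _ b _ h => by simpa using h)]
    refine Finset.sum_subset ?_ ?_
    · intro i hi
      simp only [Finset.mem_image, Finset.mem_range] at hi ⊢
      omega
    · intro i hi hi'
      simp only [Finset.mem_image, Finset.mem_range, not_exists, not_and] at hi hi'
      by_cases hid : d ≤ i
      · rw [Nat.choose_eq_zero_of_lt (by omega), Nat.cast_zero, mul_zero]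
      · have hodd : Odd i := by
          by_contra h
          obtain ⟨k, hk⟩ := Nat.not_odd_iff_even.1 h
          exact hi' k (by omega) (by omega)
        have : Odd (2 * n - i) := Nat.Even.sub_odd hi.le (even_two_mul n) hodd
        rw [genocchiPolynomial_coeff hi.le, bernoulli_eq_zero_of_odd this (by omega)]
        simp
  rw [← zero_div ((2 : ℚ) ^ (2 * d - 1) * d), ← hsum, Finset.sum_div]
  refine Finset.sum_congr rfl fun j hj => ?_
  rw [Finset.mem_range] at hj
  rw [genocchiPolynomial_coeff (by omega), show 2 * (d - 1) - 2 * j = 2 * d - 2 * j - 2 by omega]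
  ring
end

section
/- For all positive integers n and d with d ≥ 2n, one has Σ_{j=0}^{⌊(d-1)/2⌋} ((2^{2n-2j} - 1) B_{2n-2j} / (2^{2d-1} d)) · C(2d-2j-2, d-1) · C(2n, 2j) = (n / (2^{2d-1} d)) · C(2d-2n-1, d-1), where C(a,b) denotes the binomial coefficient (so in particular C(2n,2j) = 0 whenever 2j > 2n). -/
open scoped BigOperators

open PowerSeries in
/-- The exponential generating function of `(2 ^ m - 1) * bernoulli m`, which is `-t / (e ^ t + 1)`. -/
noncomputable def bernoulliTwistPowerSeries : PowerSeries ℚ :=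
  rescale 2 (bernoulliPowerSeries ℚ) - bernoulliPowerSeries ℚ

open PowerSeries in
theorem coeff_bernoulliTwistPowerSeries (m : ℕ) :
    coeff m bernoulliTwistPowerSeries = (2 ^ m - 1) * bernoulli m / m.factorial := by
  simp only [bernoulliTwistPowerSeries, bernoulliPowerSeries, map_sub, coeff_rescale, coeff_mk,
    Algebra.algebraMap_self, RingHom.id_apply]
  ring

open PowerSeries in
theorem exp_rat_sub_one_ne_zero : exp ℚ - 1 ≠ 0 := fun h => by
  have := congrArg (coeff 1) h
  simp [coeff_one] at this

open PowerSeries in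
theorem bernoulliTwistPowerSeries_mul_exp_add_one :
    bernoulliTwistPowerSeries * (exp ℚ + 1) = -X := by
  have hF := bernoulliPowerSeries_mul_exp_sub_one ℚ
  have h2 := congrArg (rescale (2 : ℚ)) hF
  have he : rescale (2 : ℚ) (exp ℚ) = exp ℚ ^ 2 := by
    simpa using (exp_pow_eq_rescale_exp (A := ℚ) 2).symm
  have hC : (C (2 : ℚ) : PowerSeries ℚ) = 2 := map_ofNat C 2
  rw [map_mul, map_sub, map_one, he, rescale_X, hC] at h2
  refine mul_right_cancel₀ exp_rat_sub_one_ne_zero ?_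
  rw [bernoulliTwistPowerSeries]
  linear_combination h2 - (exp ℚ + 1) * hF

open PowerSeries in
theorem evalNegHom_bernoulliTwistPowerSeries :
    evalNegHom bernoulliTwistPowerSeries = -(exp ℚ * bernoulliTwistPowerSeries) := by
  have h := bernoulliTwistPowerSeries_mul_exp_add_one
  have hneg := congrArg evalNegHom h
  rw [map_mul, map_add, map_one, map_neg, evalNegHom_X] at hneg
  have he := exp_mul_exp_neg_eq_one (A := ℚ)
  have hne : exp ℚ + 1 ≠ 0 := fun h0 => by
    have := congrArg (coeff 1) h0
    simp [coeff_one] at this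
  refine mul_right_cancel₀ hne ?_
  linear_combination exp ℚ * hneg + exp ℚ * h - evalNegHom bernoulliTwistPowerSeries * he

theorem sum_antidiagonal_div_factorial (f g : ℕ → ℚ) (m : ℕ) :
    ∑ p ∈ Finset.HasAntidiagonal.antidiagonal m, f p.1 / p.1.factorial * (g p.2 / p.2.factorial) =
      (∑ i ∈ Finset.range (m + 1), (m.choose i : ℚ) * f i * g (m - i)) / m.factorial := by
  rw [Finset.Nat.sum_antidiagonal_eq_sum_range_succ
    (fun i j => f i / i.factorial * (g j / j.factorial)), Finset.sum_div]
  refine Finset.sum_congr rfl fun i hi => ?_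
  have hi : i ≤ m := by simpa [Nat.lt_succ_iff] using hi
  rw [Nat.cast_choose ℚ hi]
  have := Nat.factorial_ne_zero m
  field_simp

open PowerSeries in
/-- If a sequence is its own binomial transform below an even `N`, then it is annihilated by
binomial convolution with `(2 ^ m - 1) * bernoulli m` in degree `N`. -/
theorem sum_choose_mul_bernoulli_mul_eq_zero (c : ℕ → ℚ) {N : ℕ} (hN : Even N)
    (hc : ∀ m < N, ∑ i ∈ Finset.range (m + 1), (-1) ^ i * (m.choose i : ℚ) * c i = c m) :
    ∑ k ∈ Finset.range (N + 1),
      (N.choose k : ℚ) * c k * ((2 ^ (N - k) - 1) * bernoulli (N - k)) = 0 := by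
  set G := bernoulliTwistPowerSeries with hG
  let S : PowerSeries ℚ := mk fun k => c k / k.factorial
  have hS : ∀ m < N, coeff m S = coeff m (evalNegHom S * exp ℚ) := fun m hm => by
    have h := sum_antidiagonal_div_factorial (fun i => (-1) ^ i * c i) (fun _ => 1) m
    have hcm := hc m hm
    simp only [S, coeff_mul, evalNegHom, coeff_rescale, coeff_mk, coeff_exp,
      Algebra.algebraMap_self, RingHom.id_apply]
    simp only [mul_div_assoc] at h
    rw [h, ← hcm]
    congr 1
    exact Finset.sum_congr rfl fun i _ => by ring
  have hSG : coeff N (S * G) = coeff N (evalNegHom S * exp ℚ * G) := by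
    rw [coeff_mul, coeff_mul]
    refine Finset.sum_congr rfl fun p hp => ?_
    rw [Finset.HasAntidiagonal.mem_antidiagonal] at hp
    rcases Nat.eq_zero_or_pos p.2 with h0 | h0
    · simp [h0, hG, coeff_bernoulliTwistPowerSeries, -coeff_zero_eq_constantCoeff]
    · rw [hS p.1 (by omega)]
  have hodd : evalNegHom S * exp ℚ * G = -evalNegHom (S * G) := by
    rw [map_mul, hG, evalNegHom_bernoulliTwistPowerSeries]
    ring
  rw [hodd, map_neg, evalNegHom, coeff_rescale, hN.neg_one_pow, one_mul] at hSG
  have hzero : coeff N (S * G) = 0 := by linarith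
  rw [coeff_mul] at hzero
  simp only [S, hG, coeff_mk, coeff_bernoulliTwistPowerSeries] at hzero
  rw [sum_antidiagonal_div_factorial c (fun m => (2 ^ m - 1) * bernoulli m)] at hzero
  exact (div_eq_zero_iff.mp hzero).resolve_right (by exact_mod_cast N.factorial_ne_zero)

theorem sum_neg_one_pow_mul_choose_mul_choose_s11 {m d : ℕ} (hm : m < d) :
    ∑ i ∈ Finset.range (m + 1),
      (-1) ^ i * (m.choose i : ℚ) * ((2 * d - 2 - i).choose (d - 1) : ℚ) =
        ((2 * d - 2 - m).choose (d - 1) : ℚ) := by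
  have h := congrFun (fwdDiff_iter_choose (d - 1 - m) m) (2 * d - 2 - m)
  rw [fwdDiff_iter_eq_sum_shift, ← Finset.sum_range_reflect,
    Nat.choose_symm_of_eq_add (show 2 * d - 2 - m = (d - 1 - m) + (d - 1) by omega)] at h
  simp only [smul_eq_mul, mul_one] at h
  have h' := congrArg (Int.cast : ℤ → ℚ) h
  push_cast at h'
  rw [← h']
  refine Finset.sum_congr rfl fun i hi => ?_
  have hi : i ≤ m := by simpa [Nat.lt_succ_iff] using hi
  rw [show m - (m - i) = i by omega, Nat.choose_symm hi,
    show m + (d - 1 - m) = d - 1 by omega]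
  rw [show 2 * d - 2 - m + (m - i) = 2 * d - 2 - i by omega]

theorem sum_range_two_mul {M : Type*} [AddCommMonoid M] (f : ℕ → M) (n : ℕ) :
    ∑ k ∈ Finset.range (2 * n), f k =
      ∑ j ∈ Finset.range n, f (2 * j) + ∑ j ∈ Finset.range n, f (2 * j + 1) := by
  rw [← Finset.sum_add_distrib]
  induction n with
  | zero => simp
  | succ n ih =>
    rw [show 2 * (n + 1) = 2 * n + 1 + 1 by ring, Finset.sum_range_succ, Finset.sum_range_succ, ih,
      Finset.sum_range_succ, add_assoc]

theorem sum_choose_mul_bernoulli_mul_choose {n d : ℕ} (hn : 1 ≤ n) (hd : 2 * n ≤ d) :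
    ∑ j ∈ Finset.range n, ((2 * n).choose (2 * j) : ℚ) * ((2 * d - 2 - 2 * j).choose (d - 1) : ℚ) *
        ((2 ^ (2 * n - 2 * j) - 1) * bernoulli (2 * n - 2 * j)) =
      n * ((2 * d - 2 * n - 1).choose (d - 1) : ℚ) := by
  have h := sum_choose_mul_bernoulli_mul_eq_zero
    (fun k => ((2 * d - 2 - k).choose (d - 1) : ℚ)) (even_two_mul n)
    fun m hm => sum_neg_one_pow_mul_choose_mul_choose_s11 (by omega)
  rw [Finset.sum_range_succ, sum_range_two_mul] at h
  have hodd : ∑ j ∈ Finset.range n, ((2 * n).choose (2 * j + 1) : ℚ) *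
      ((2 * d - 2 - (2 * j + 1)).choose (d - 1) : ℚ) *
        ((2 ^ (2 * n - (2 * j + 1)) - 1) * bernoulli (2 * n - (2 * j + 1))) =
      -(n * ((2 * d - 2 * n - 1).choose (d - 1) : ℚ)) := by
    rw [Finset.sum_eq_single_of_mem (n - 1) (by simp; omega)]
    · have hc : (2 * n).choose (2 * (n - 1) + 1) = 2 * n := by
        rw [Nat.choose_symm_of_eq_add (show 2 * n = (2 * (n - 1) + 1) + 1 by omega),
          Nat.choose_one_right]
      rw [hc, show 2 * n - (2 * (n - 1) + 1) = 1 by omega,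
        show 2 * d - 2 - (2 * (n - 1) + 1) = 2 * d - 2 * n - 1 by omega, bernoulli_one]
      push_cast
      ring
    · intro j hj hjn
      rw [Finset.mem_range] at hj
      rw [bernoulli_eq_zero_of_odd ⟨n - j - 1, by omega⟩ (by omega)]
      simp
  rw [hodd] at h
  simp only [Nat.sub_self, pow_zero, sub_self, zero_mul, mul_zero, add_zero] at h
  linarith

/-- Evaluation of the Bernoulli-number sum for `d ≥ 2n`
(Theorem 3.1, second identity, second case). -/
theorem bernoulli_sum_eval (n d : ℕ) (hn : 1 ≤ n) (hd : 2 * n ≤ d) :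
    ∑ j ∈ Finset.range ((d - 1) / 2 + 1),
        ((2 ^ (2 * n - 2 * j) - 1) * bernoulli (2 * n - 2 * j) / (2 ^ (2 * d - 1) * d)) *
          ((2 * d - 2 * j - 2).choose (d - 1)) * ((2 * n).choose (2 * j))
      = ((n : ℚ) / (2 ^ (2 * d - 1) * d)) * ((2 * d - 2 * n - 1).choose (d - 1)) := by
  rw [div_mul_eq_mul_div, ← sum_choose_mul_bernoulli_mul_choose hn hd, Finset.sum_div]
  symm
  refine Finset.sum_subset_zero_on_sdiff (Finset.range_mono (by omega)) (fun j hj => ?_)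
    fun j _ => ?_
  · have hj : n ≤ j := by simp at hj; omega
    rw [show 2 * n - 2 * j = 0 by omega]
    simp
  · rw [Nat.sub_right_comm (2 * d) 2 (2 * j)]
    ring
end

section
/- For every integer n ≥ 5, T(2n,5) = (7/128)·t(2n) − (3/64)·t(2)·t(2n-2) + (1/320)·t(4)·t(2n-4), where t(2m) = Σ_{k≥1} 1/(2k-1)^{2m}. -/
open scoped BigOperators

/-- Depth-one multiple t-value: `t1 m = t(2m) = ∑_{k ≥ 1} 1/(2k-1)^{2m}`. -/
noncomputable def t1 (m : ℕ) : ℝ := ∑' k : ℕ, 1 / (2 * (k : ℝ) + 1) ^ (2 * m)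

/-- Multiple t-value `t(s₀, …, s_{d-1})`, summed over `n₀ > n₁ > ⋯ > n_{d-1} ≥ 1`
(encoded via `f i = n_i - 1`, so the odd number `2 n_i - 1` is `2 (f i) + 1`). -/
noncomputable def mtv (d : ℕ) (s : Fin d → ℕ) : ℝ :=
  ∑' f : {f : Fin d → ℕ // StrictAnti f}, ∏ i, 1 / (2 * (f.1 i : ℝ) + 1) ^ (s i)

/-- `Tsum n d = T(2n, d)`: the sum of all multiple t-values of weight `2n` and
depth `d` with all arguments even. -/
noncomputable def Tsum (n d : ℕ) : ℝ :=
  ∑ j ∈ (Finset.Nat.antidiagonalTuple d n).filter (fun j => ∀ i, 1 ≤ j i),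
    mtv d (fun i => 2 * j i)

open Filter Topology Finset

/-- The variable `x k = 1 / (2 k + 1) ^ 2`, whose power sums are the values `t1`. -/
noncomputable def oddInvSq (k : ℕ) : ℝ := 1 / (2 * (k : ℝ) + 1) ^ 2

lemma oddInvSq_pos (k : ℕ) : 0 < oddInvSq k := by unfold oddInvSq; positivity

lemma oddInvSq_le_one (k : ℕ) : oddInvSq k ≤ 1 := by
  unfold oddInvSq
  rw [div_le_one (by positivity)]
  nlinarith [(Nat.cast_nonneg k : (0 : ℝ) ≤ k)]

lemma oddInvSq_pow (k m : ℕ) : oddInvSq k ^ m = 1 / (2 * (k : ℝ) + 1) ^ (2 * m) := by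
  rw [oddInvSq, div_pow, one_pow, pow_mul]

lemma summable_oddInvSq : Summable oddInvSq := by
  have h := (summable_nat_add_iff 1).2 (Real.summable_one_div_nat_pow.2 one_lt_two)
  refine Summable.of_nonneg_of_le (fun k => (oddInvSq_pos k).le) (fun k => ?_) h
  unfold oddInvSq
  push_cast
  gcongr
  linarith [(Nat.cast_nonneg k : (0 : ℝ) ≤ k)]

lemma summable_oddInvSq_pow {m : ℕ} (hm : 1 ≤ m) : Summable fun k => oddInvSq k ^ m :=
  Summable.of_nonneg_of_le (fun k => pow_nonneg (oddInvSq_pos k).le _)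
    (fun k => pow_le_of_le_one (oddInvSq_pos k).le (oddInvSq_le_one k) (by omega))
    summable_oddInvSq

lemma hasSum_t1 {m : ℕ} (hm : 1 ≤ m) : HasSum (fun k => oddInvSq k ^ m) (t1 m) := by
  have := (summable_oddInvSq_pow hm).hasSum
  simpa only [t1, oddInvSq_pow] using this

/-- The kernel `1 / (b ^ 2 - a ^ 2)` with `a = 2 k + 1`, `b = 2 m + 1`, which vanishes on the
diagonal by the convention `1 / 0 = 0`. -/
noncomputable def oddKernel (k m : ℕ) : ℝ :=
  1 / ((2 * (m : ℝ) + 1) ^ 2 - (2 * (k : ℝ) + 1) ^ 2)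

lemma oddKernel_eq (k m : ℕ) :
    oddKernel k m = 1 / (4 * (2 * (k : ℝ) + 1)) *
      ((1 / ((m : ℝ) - k) - 1 / ((m : ℝ) + k + 1)) +
        if m = k then 1 / (2 * (k : ℝ) + 1) else 0) := by
  unfold oddKernel
  split_ifs with h
  · subst h
    simp
    right
    ring
  · have h1 : (m : ℝ) - k ≠ 0 := sub_ne_zero.2 (by exact_mod_cast h)
    have h2 : (m : ℝ) + k + 1 ≠ 0 := by positivity
    have h3 : (2 * (m : ℝ) + 1) ^ 2 - (2 * (k : ℝ) + 1) ^ 2 = 4 * (m - k) * (m + k + 1) := by ring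
    rw [h3]
    have h4 : 2 * (k : ℝ) + 1 ≠ 0 := by positivity
    field_simp
    ring

lemma sum_shift_sub (g : ℝ → ℝ) (c : ℝ) (N : ℕ) :
    ∑ m ∈ range N, (g ((m : ℝ) - (c + 1)) - g ((m : ℝ) - c)) =
      g (-(c + 1)) - g ((N : ℝ) - (c + 1)) := by
  have := Finset.sum_range_sub' (fun m : ℕ => g ((m : ℝ) - (c + 1))) N
  simp only [Nat.cast_zero, zero_sub] at this
  rw [← this]
  refine Finset.sum_congr rfl fun m _ => ?_
  push_cast
  ring_nf

lemma tendsto_one_div_natCast_add (c : ℝ) :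
    Tendsto (fun N : ℕ => 1 / ((N : ℝ) + c)) atTop (𝓝 0) :=
  tendsto_const_nhds.div_atTop
    (tendsto_atTop_add_const_right _ _ tendsto_natCast_atTop_atTop)

lemma tendsto_sum_telescope (k : ℕ) :
    Tendsto (fun N : ℕ => ∑ m ∈ range N, (1 / ((m : ℝ) - k) - 1 / ((m : ℝ) + k + 1)))
      atTop (𝓝 0) := by
  induction k with
  | zero =>
    have h : ∀ N : ℕ, ∑ m ∈ range N, (1 / ((m : ℝ) - (0 : ℕ)) - 1 / ((m : ℝ) + (0 : ℕ) + 1)) =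
        -(1 / ((N : ℝ) + 0)) := by
      intro N
      have := Finset.sum_range_sub' (fun m : ℕ => 1 / (m : ℝ)) N
      simp only [Nat.cast_zero, div_zero, zero_sub, Nat.cast_add, Nat.cast_one] at this
      simpa using this
    simp_rw [h]
    simpa using (tendsto_one_div_natCast_add 0).neg
  | succ k ih =>
    have h : ∀ N : ℕ, ∑ m ∈ range N,
        (1 / ((m : ℝ) - (k + 1 : ℕ)) - 1 / ((m : ℝ) + (k + 1 : ℕ) + 1)) =
        ∑ m ∈ range N, (1 / ((m : ℝ) - k) - 1 / ((m : ℝ) + k + 1)) -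
          1 / ((N : ℝ) + (-(k + 1))) - 1 / ((N : ℝ) + (k + 1)) := by
      intro N
      have h1 := sum_shift_sub (fun x => 1 / x) k N
      have h2 := sum_shift_sub (fun x => 1 / x) (-(k + 2)) N
      simp only [← sub_eq_zero (b := (_ : ℝ) - _), Finset.sum_sub_distrib] at h1 h2 ⊢
      push_cast
      have e1 : ∀ m : ℕ, (m : ℝ) - (-(k + 2) + 1) = m + k + 1 := fun m => by ring
      have e2 : ∀ m : ℕ, (m : ℝ) - (-(k + 2)) = m + (k + 1) + 1 := fun m => by ring
      have e3 : -(-((k : ℝ) + 2) + 1) = k + 1 := by ring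
      have e4 : (N : ℝ) + k + 1 = N + (k + 1) := by ring
      have e5 : (N : ℝ) - (k + 1) = N + (-(k + 1)) := by ring
      have e6 : 1 / (-((k : ℝ) + 1)) = -(1 / (k + 1)) := by rw [one_div_neg_eq_neg_one_div]
      simp only [e1, e2, e3, e4, e5, e6] at h1 h2 ⊢
      linear_combination h1 + h2
    simp_rw [h]
    simpa using (ih.sub (tendsto_one_div_natCast_add _)).sub (tendsto_one_div_natCast_add _)

lemma tendsto_sum_oddKernel (k : ℕ) :
    Tendsto (fun N : ℕ => ∑ m ∈ range N, oddKernel k m) atTop (𝓝 (oddInvSq k / 4)) := by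
  have h : ∀ᶠ N : ℕ in atTop, 1 / (4 * (2 * (k : ℝ) + 1)) *
      (∑ m ∈ range N, (1 / ((m : ℝ) - k) - 1 / ((m : ℝ) + k + 1)) + 1 / (2 * (k : ℝ) + 1)) =
      ∑ m ∈ range N, oddKernel k m := by
    filter_upwards [eventually_gt_atTop k] with N hN
    simp_rw [oddKernel_eq, ← Finset.mul_sum, Finset.sum_add_distrib]
    rw [Finset.sum_ite_eq' (range N) k, if_pos (mem_range.2 hN)]
  refine Tendsto.congr' h ?_
  have := ((tendsto_sum_telescope k).add_const (1 / (2 * (k : ℝ) + 1))).const_mul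
    (1 / (4 * (2 * (k : ℝ) + 1)))
  convert this using 2
  unfold oddInvSq
  field_simp
  ring

lemma cube_le_mul_sq_sub_sq {a b : ℝ} (ha : 1 ≤ a) (hb : 1 ≤ b) (hab : 1 ≤ (b - a) ^ 2) :
    b ^ 3 ≤ 4 * a * (b ^ 2 - a ^ 2) ^ 2 := by
  have e : (b ^ 2 - a ^ 2) ^ 2 = (b - a) ^ 2 * (b + a) ^ 2 := by ring
  rw [e]
  have hba : b ^ 2 ≤ (b + a) ^ 2 := by gcongr; linarith
  rcases le_total b (2 * a) with h | h
  · have h1 : b ^ 2 ≤ (b - a) ^ 2 * (b + a) ^ 2 := by nlinarith [sq_nonneg (b + a)]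
    calc b ^ 3 = b * b ^ 2 := by ring
      _ ≤ (4 * a) * ((b - a) ^ 2 * (b + a) ^ 2) := by gcongr; linarith
  · have h1 : (b / 2) ^ 2 ≤ (b - a) ^ 2 := by gcongr; linarith
    calc b ^ 3 ≤ b ^ 4 := pow_le_pow_right₀ hb (by norm_num)
      _ = 4 * 1 * ((b / 2) ^ 2 * b ^ 2) := by ring
      _ ≤ 4 * a * ((b - a) ^ 2 * (b + a) ^ 2) := by gcongr

lemma abs_oddInvSq_mul_oddKernel_le (k m : ℕ) :
    |oddInvSq k * oddKernel k m| ≤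
      2 * (((k : ℝ) + 1) ^ (-(3 / 2 : ℝ)) * ((m : ℝ) + 1) ^ (-(3 / 2 : ℝ))) := by
  have hsq : ∀ j : ℕ, (((j : ℝ) + 1) ^ (-(3 / 2 : ℝ))) ^ 2 = 1 / ((j : ℝ) + 1) ^ 3 := by
    intro j
    rw [← Real.rpow_natCast, ← Real.rpow_mul (by positivity), one_div, ← Real.rpow_natCast,
      ← Real.rpow_neg (by positivity)]
    norm_num
  refine abs_le_of_sq_le_sq ?_ (by positivity)
  rw [mul_pow, mul_pow, mul_pow, hsq, hsq]
  by_cases hkm : k = m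
  · subst hkm
    simp only [oddKernel, sub_self, div_zero]
    norm_num
    positivity
  set a : ℝ := 2 * (k : ℝ) + 1 with ha
  set b : ℝ := 2 * (m : ℝ) + 1 with hb
  have ha1 : 1 ≤ a := by rw [ha]; linarith [(Nat.cast_nonneg k : (0 : ℝ) ≤ k)]
  have hb1 : 1 ≤ b := by rw [hb]; linarith [(Nat.cast_nonneg m : (0 : ℝ) ≤ m)]
  have hab : 1 ≤ (b - a) ^ 2 := by
    have h0 : (m : ℤ) - k ≠ 0 := sub_ne_zero.2 (by exact_mod_cast (Ne.symm hkm))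
    have h1 : 1 ≤ ((m : ℤ) - k) ^ 2 := by
      have := sq_pos_of_ne_zero h0
      omega
    have h2 : (1 : ℝ) ≤ ((m : ℝ) - k) ^ 2 := by exact_mod_cast h1
    rw [ha, hb]
    nlinarith
  have key := cube_le_mul_sq_sub_sq ha1 hb1 hab
  have hpos : 0 < (b ^ 2 - a ^ 2) ^ 2 := by
    by_contra! h
    have h3 : 0 < b ^ 3 := by positivity
    nlinarith
  have hka : (k : ℝ) + 1 ≤ a := by rw [ha]; linarith [(Nat.cast_nonneg k : (0 : ℝ) ≤ k)]
  have hmb : (m : ℝ) + 1 ≤ b := by rw [hb]; linarith [(Nat.cast_nonneg m : (0 : ℝ) ≤ m)]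
  have e1 : oddInvSq k ^ 2 * oddKernel k m ^ 2 = 1 / (a ^ 4 * (b ^ 2 - a ^ 2) ^ 2) := by
    rw [oddInvSq, oddKernel, ← ha, ← hb, div_pow, div_pow, div_mul_div_comm]
    ring
  calc oddInvSq k ^ 2 * oddKernel k m ^ 2 = 1 / (a ^ 4 * (b ^ 2 - a ^ 2) ^ 2) := e1
    _ ≤ 4 / (a ^ 3 * b ^ 3) := by
      rw [div_le_div_iff₀ (by positivity) (by positivity)]
      have : 0 < a ^ 3 := by positivity
      nlinarith [mul_le_mul_of_nonneg_left key this.le]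
    _ ≤ 4 / (((k : ℝ) + 1) ^ 3 * ((m : ℝ) + 1) ^ 3) := by gcongr
    _ = 2 ^ 2 * (1 / ((k : ℝ) + 1) ^ 3 * (1 / ((m : ℝ) + 1) ^ 3)) := by
      field_simp
      norm_num

lemma summable_oddInvSq_pow_mul_oddKernel (N : ℕ) :
    Summable fun z : ℕ × ℕ => oddInvSq z.1 ^ (N + 1) * oddKernel z.1 z.2 := by
  have hc : Summable fun k : ℕ => ((k : ℝ) + 1) ^ (-(3 / 2 : ℝ)) := by
    have := (summable_nat_add_iff 1).2 (Real.summable_nat_rpow.2 (by norm_num : -(3 / 2 : ℝ) < -1))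
    simpa using this
  have hcc := hc.mul_of_nonneg hc (fun k => by positivity) (fun k => by positivity)
  refine Summable.of_norm_bounded (hcc.mul_left 2) fun z => ?_
  refine le_trans ?_ (abs_oddInvSq_mul_oddKernel_le z.1 z.2)
  rw [Real.norm_eq_abs, abs_mul, abs_mul, abs_of_pos (oddInvSq_pos _),
    abs_of_pos (pow_pos (oddInvSq_pos _) _)]
  gcongr
  exact pow_le_of_le_one (oddInvSq_pos _).le (oddInvSq_le_one _) (by omega)

lemma hasSum_oddKernel (k : ℕ) : HasSum (oddKernel k) (oddInvSq k / 4) := by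
  have h := (summable_oddInvSq_pow_mul_oddKernel 0).prod_factor k
  have h2 : Summable (oddKernel k) :=
    (summable_mul_left_iff (pow_pos (oddInvSq_pos k) (0 + 1)).ne').1 h
  have := tendsto_nhds_unique h2.hasSum.tendsto_sum_nat (tendsto_sum_oddKernel k)
  exact this ▸ h2.hasSum

lemma hasSum_oddInvSq_pow_mul_oddKernel (N : ℕ) :
    HasSum (fun z : ℕ × ℕ => oddInvSq z.1 ^ (N + 1) * oddKernel z.1 z.2) (t1 (N + 2) / 4) := by
  have h := (summable_oddInvSq_pow_mul_oddKernel N).hasSum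
  have h1 := h.prod_fiberwise fun k => (hasSum_oddKernel k).mul_left (oddInvSq k ^ (N + 1))
  have h2 := (hasSum_t1 (m := N + 2) (by omega)).div_const 4
  have e : (fun k => oddInvSq k ^ (N + 1) * (oddInvSq k / 4)) =
      fun k => oddInvSq k ^ (N + 2) / 4 := funext fun k => by ring
  rw [e] at h1
  exact h1.unique h2 ▸ h

lemma sum_oddInvSq_pow_mul_pow (N k m : ℕ) :
    ∑ i ∈ range (N + 1), oddInvSq k ^ (i + 1) * oddInvSq m ^ (N + 1 - i) =
      (if k = m then (N + 1 : ℝ) * oddInvSq k ^ (N + 2) else 0) +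
        (oddInvSq k ^ (N + 1) * oddKernel k m + oddInvSq m ^ (N + 1) * oddKernel m k) := by
  split_ifs with h
  · subst h
    have hD : oddKernel k k = 0 := by simp [oddKernel]
    have : ∀ i ∈ range (N + 1), oddInvSq k ^ (i + 1) * oddInvSq k ^ (N + 1 - i) =
        oddInvSq k ^ (N + 2) := by
      intro i hi
      rw [← pow_add]
      congr 1
      have := mem_range.1 hi
      omega
    rw [Finset.sum_congr rfl this, hD]
    simp
  · set x := oddInvSq k with hx
    set y := oddInvSq m with hy
    have hx0 : x ≠ 0 := (oddInvSq_pos k).ne'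
    have hy0 : y ≠ 0 := (oddInvSq_pos m).ne'
    have hxy : x - y ≠ 0 := by
      rw [hx, hy, oddInvSq, oddInvSq, sub_ne_zero, Ne, one_div, one_div, inv_inj,
        sq_eq_sq₀ (by positivity) (by positivity)]
      intro h'
      exact h (by exact_mod_cast (by linarith : (k : ℝ) = m))
    have hk : oddKernel k m = x * y / (x - y) := by
      have e1 : (2 * (k : ℝ) + 1) ^ 2 = 1 / x := by rw [hx, oddInvSq, one_div_one_div]
      have e2 : (2 * (m : ℝ) + 1) ^ 2 = 1 / y := by rw [hy, oddInvSq, one_div_one_div]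
      rw [oddKernel, e1, e2, div_sub_div _ _ hy0 hx0, one_div_div]
      ring
    have hm : oddKernel m k = -(x * y / (x - y)) := by
      rw [← hk, oddKernel, oddKernel, ← one_div_neg_eq_neg_one_div, neg_sub]
    have hs : ∑ i ∈ range (N + 1), x ^ (i + 1) * y ^ (N + 1 - i) =
        x * y * ∑ i ∈ range (N + 1), x ^ i * y ^ (N - i) := by
      rw [Finset.mul_sum]
      refine Finset.sum_congr rfl fun i hi => ?_
      have := mem_range.1 hi
      rw [show N + 1 - i = (N - i) + 1 by omega]
      ring
    have hg := geom_sum₂_mul x y (N + 1)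
    simp only [Nat.add_sub_cancel] at hg
    rw [hs, hk, hm]
    field_simp
    linear_combination x * y * hg

lemma hasSum_oddInvSq_pow_mul_pow {i j : ℕ} (hi : 1 ≤ i) (hj : 1 ≤ j) :
    HasSum (fun z : ℕ × ℕ => oddInvSq z.1 ^ i * oddInvSq z.2 ^ j) (t1 i * t1 j) := by
  have h1 := hasSum_t1 hi
  have h2 := hasSum_t1 hj
  have h0 : ∀ l : ℕ, 0 ≤ fun k => oddInvSq k ^ l :=
    fun l k => pow_nonneg (oddInvSq_pos k).le l
  exact h1.mul h2 (h1.summable.mul_of_nonneg h2.summable (h0 i) (h0 j))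

/-- Euler's convolution identity for the values `t(2m)`. -/
lemma sum_t1_mul_t1 (N : ℕ) :
    ∑ i ∈ range (N + 1), t1 (i + 1) * t1 (N + 1 - i) = (N + 3 / 2 : ℝ) * t1 (N + 2) := by
  have hprod : ∀ i ∈ range (N + 1),
      HasSum (fun z : ℕ × ℕ => oddInvSq z.1 ^ (i + 1) * oddInvSq z.2 ^ (N + 1 - i))
        (t1 (i + 1) * t1 (N + 1 - i)) := fun i hi =>
    hasSum_oddInvSq_pow_mul_pow (by omega) (by have := mem_range.1 hi; omega)
  have hL := hasSum_sum hprod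
  have hK := hasSum_oddInvSq_pow_mul_oddKernel N
  have hdiag : HasSum (fun z : ℕ × ℕ => if z.1 = z.2 then (N + 1 : ℝ) * oddInvSq z.1 ^ (N + 2)
      else 0) ((N + 1 : ℝ) * t1 (N + 2)) := by
    have h := (hasSum_t1 (m := N + 2) (by omega)).mul_left (N + 1 : ℝ)
    have hinj : Function.Injective fun k : ℕ => (k, k) := fun a b hab => (Prod.mk.inj hab).1
    refine (hinj.hasSum_iff ?_).1 (by simpa [Function.comp_def] using h)
    rintro ⟨a, b⟩ hab
    refine if_neg fun h => hab ⟨a, ?_⟩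
    exact Prod.ext rfl h
  have hK' : HasSum (fun z : ℕ × ℕ => oddInvSq z.2 ^ (N + 1) * oddKernel z.2 z.1)
      (t1 (N + 2) / 4) := (Equiv.prodComm ℕ ℕ).hasSum_iff.2 hK
  have hR := hdiag.add (hK.add hK')
  simp only [← sum_oddInvSq_pow_mul_pow] at hR
  rw [hL.unique hR]
  ring

/-- The generating series `∑ t(2m) X ^ m`. -/
noncomputable def t1Series : PowerSeries ℝ := PowerSeries.mk fun m => if m = 0 then 0 else t1 m

open PowerSeries in
lemma t1Series_riccati :
    2 * t1Series ^ 2 = 2 * (X * d⁄dX ℝ t1Series) - t1Series - C (t1 1) * X := by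
  ext n
  have h2 : ∀ F : PowerSeries ℝ, coeff n (2 * F) = 2 * coeff n F := fun F => by
    rw [two_mul, map_add, two_mul]
  rw [map_sub, map_sub, h2, h2, coeff_C_mul, pow_two, coeff_mul,
    Finset.Nat.sum_antidiagonal_eq_sum_range_succ_mk]
  match n with
  | 0 => simp [t1Series]
  | 1 => simp [t1Series, Finset.sum_range_succ, coeff_succ_X_mul, coeff_derivative]; ring
  | N + 2 =>
    rw [Finset.sum_range_succ, Finset.sum_range_succ']
    have h := sum_t1_mul_t1 N
    have e : ∀ i ∈ range (N + 1), coeff (i + 1) t1Series * coeff (N + 2 - (i + 1)) t1Series =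
        t1 (i + 1) * t1 (N + 1 - i) := by
      intro i hi
      have hi := mem_range.1 hi
      rw [show N + 2 - (i + 1) = N + 1 - i by omega]
      simp only [t1Series, coeff_mk]
      rw [if_neg (by omega), if_neg (by omega)]
    rw [Finset.sum_congr rfl e, h]
    simp [t1Series, coeff_succ_X_mul, coeff_derivative, coeff_X]
    ring

open PowerSeries in
/-- Solving the depth recursion with the Riccati equation of the depth-one series. -/
lemma depth_five_of_recursion {f p F₂ F₃ F₄ F₅ : PowerSeries ℝ} (hp : d⁄dX ℝ p = 0)
    (hf : 2 * f ^ 2 = 2 * (X * d⁄dX ℝ f) - f - p * X)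
    (h₂ : 2 * F₂ + X * d⁄dX ℝ f = f * f + f)
    (h₃ : 3 * F₃ + X * d⁄dX ℝ F₂ = F₂ * f + 2 * F₂)
    (h₄ : 4 * F₄ + X * d⁄dX ℝ F₃ = F₃ * f + 3 * F₃)
    (h₅ : 5 * F₅ + X * d⁄dX ℝ F₄ = F₄ * f + 4 * F₄) :
    1920 * F₅ = 105 * f - 90 * (p * X * f) + 4 * (p ^ 2 * X ^ 2 * f) - 105 * (p * X) +
      20 * (p ^ 2 * X ^ 2) := by
  have hnum : ∀ (c : ℕ) [c.AtLeastTwo], d⁄dX ℝ (OfNat.ofNat c : PowerSeries ℝ) = 0 := fun c _ =>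
    Derivation.map_natCast _ c
  have e₂ : 4 * F₂ = f - p * X := by linear_combination 2 * h₂ + hf
  have d₂ := congrArg (d⁄dX ℝ) e₂
  simp only [map_sub, Derivation.leibniz, smul_eq_mul, hnum, hp, derivative_X] at d₂
  have e₃ : 24 * F₃ = 3 * f - 2 * (p * X * f) - 3 * (p * X) := by
    linear_combination 8 * h₃ - 2 * X * d₂ + (2 * f + 4) * e₂ + hf
  have d₃ := congrArg (d⁄dX ℝ) e₃
  simp only [map_sub, Derivation.leibniz, smul_eq_mul, hnum, hp, derivative_X] at d₃
  have e₄ : 192 * F₄ = 15 * f - 12 * (p * X * f) - 15 * (p * X) + 2 * (p ^ 2 * X ^ 2) := by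
    linear_combination 48 * h₄ - 2 * X * d₃ + (2 * f + 6) * e₃ + (3 - 2 * p * X) * hf
  have d₄ := congrArg (d⁄dX ℝ) e₄
  simp only [map_sub, map_add, Derivation.leibniz, smul_eq_mul, hnum, hp, derivative_X, pow_two]
    at d₄
  linear_combination 384 * h₅ - 2 * X * d₄ + (2 * f + 8) * e₄ + (15 - 12 * p * X) * hf

/-- The series `x X / (1 - x X)` attached to the variable `x k`. -/
noncomputable def geomSeries (k : ℕ) : PowerSeries ℝ :=
  PowerSeries.mk fun i => if i = 0 then 0 else oddInvSq k ^ i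

/-- The elementary symmetric series of degree `d` in `geomSeries 0, …, geomSeries (N - 1)`. -/
noncomputable def esymmSeries : ℕ → ℕ → PowerSeries ℝ
  | _, 0 => 1
  | 0, _ + 1 => 0
  | N + 1, d + 1 => esymmSeries N (d + 1) + geomSeries N * esymmSeries N d

lemma esymmSeries_zero_right (N : ℕ) : esymmSeries N 0 = 1 := by cases N <;> rfl

open PowerSeries in
lemma X_mul_derivative_geomSeries (k : ℕ) :
    X * d⁄dX ℝ (geomSeries k) = geomSeries k + geomSeries k ^ 2 := by
  have h : (1 - C (oddInvSq k) * X) * geomSeries k = C (oddInvSq k) * X := by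
    ext n
    rw [sub_mul, one_mul, mul_assoc, map_sub, coeff_C_mul, coeff_C_mul]
    match n with
    | 0 => simp [geomSeries]
    | 1 => simp [geomSeries, coeff_succ_X_mul]
    | n + 2 =>
      simp [geomSeries, coeff_succ_X_mul, coeff_X]
      ring
  have hd := congrArg (d⁄dX ℝ) h
  simp only [map_sub, Derivation.leibniz, smul_eq_mul, derivative_C, derivative_X,
    derivative_one] at hd
  have h0 : (1 - C (oddInvSq k) * X : PowerSeries ℝ) ≠ 0 := fun h' => by
    simpa using congrArg constantCoeff h'
  refine mul_left_cancel₀ h0 ?_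
  linear_combination X * hd - (1 + geomSeries k) * h

open PowerSeries in
lemma esymmSeries_recursion (N d : ℕ) :
    ((d + 1 : ℕ) : PowerSeries ℝ) * esymmSeries N (d + 1) + X * d⁄dX ℝ (esymmSeries N d) =
      esymmSeries N d * esymmSeries N 1 + (d : PowerSeries ℝ) * esymmSeries N d := by
  induction N generalizing d with
  | zero => cases d <;> simp [esymmSeries]
  | succ N ih =>
    cases d with
    | zero => simp [esymmSeries, esymmSeries_zero_right]
    | succ d =>
      have h1 := ih (d + 1)
      have h0 := ih d
      have hg := X_mul_derivative_geomSeries N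
      simp only [esymmSeries, esymmSeries_zero_right, map_add, Derivation.leibniz,
        smul_eq_mul]
      push_cast at h0 h1 ⊢
      linear_combination h1 + geomSeries N * h0 + esymmSeries N d * hg

/-- Strictly decreasing `d`-tuples with entries below `N`. -/
noncomputable def strictAntiBox (N d : ℕ) : Finset (Fin d → ℕ) := by
  classical exact (Fintype.piFinset fun _ => range N).filter StrictAnti

lemma mem_strictAntiBox {N d : ℕ} {f : Fin d → ℕ} :
    f ∈ strictAntiBox N d ↔ (∀ i, f i < N) ∧ StrictAnti f := by
  simp [strictAntiBox]

lemma strictAnti_cons_iff {d N : ℕ} {f : Fin d → ℕ} :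
    StrictAnti (Fin.cons N f : Fin (d + 1) → ℕ) ↔ (∀ i, f i < N) ∧ StrictAnti f := by
  constructor
  · intro h
    refine ⟨fun i => by simpa using h (Fin.succ_pos i), fun i j hij => ?_⟩
    simpa using h (Fin.succ_lt_succ_iff.2 hij)
  · rintro ⟨h1, h2⟩ i j hij
    induction i using Fin.cases with
    | zero =>
      induction j using Fin.cases with
      | zero => exact absurd hij (lt_irrefl _)
      | succ j => simpa using h1 j
    | succ i =>
      induction j using Fin.cases with
      | zero => exact absurd hij (Fin.not_lt_zero _)
      | succ j => simpa using h2 (Fin.succ_lt_succ_iff.1 hij)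

lemma sum_strictAntiBox_succ {M : Type*} [AddCommMonoid M] (N d : ℕ) (G : (Fin (d + 1) → ℕ) → M) :
    ∑ f ∈ strictAntiBox (N + 1) (d + 1), G f =
      ∑ f ∈ strictAntiBox N (d + 1), G f + ∑ f ∈ strictAntiBox N d, G (Fin.cons N f) := by
  rw [← Finset.sum_filter_add_sum_filter_not _ (fun f => f 0 < N)]
  congr 1
  · refine Finset.sum_congr ?_ fun _ _ => rfl
    ext f
    rw [mem_filter, mem_strictAntiBox, mem_strictAntiBox]
    constructor
    · rintro ⟨⟨-, h⟩, h0⟩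
      exact ⟨fun i => (h.antitone (Fin.zero_le i)).trans_lt h0, h⟩
    · rintro ⟨h1, h⟩
      exact ⟨⟨fun i => (h1 i).trans (Nat.lt_succ_self N), h⟩, h1 0⟩
  · symm
    refine Finset.sum_nbij (fun f => Fin.cons N f) ?_ ?_ ?_ fun _ _ => rfl
    · intro f hf
      rw [mem_strictAntiBox] at hf
      rw [mem_filter, mem_strictAntiBox]
      refine ⟨⟨fun i => ?_, strictAnti_cons_iff.2 hf⟩, by simp⟩
      induction i using Fin.cases with
      | zero => simp
      | succ i => simpa using (hf.1 i).trans (Nat.lt_succ_self N)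
    · exact (Fin.cons_right_injective (α := fun _ => ℕ) N).injOn
    · intro f hf
      rw [Finset.mem_coe, mem_filter, mem_strictAntiBox] at hf
      obtain ⟨⟨h1, h⟩, h0⟩ := hf
      have hN : f 0 = N := by have := h1 0; omega
      have hc : Fin.cons N (Fin.tail f) = f := by rw [← hN, Fin.cons_self_tail]
      refine ⟨Fin.tail f, ?_, hc⟩
      rw [Finset.mem_coe, mem_strictAntiBox, ← strictAnti_cons_iff, hc]
      exact h

/-- Compositions of `n` into `d` positive parts, as in the definition of `Tsum`. -/
def compositions (d n : ℕ) : Finset (Fin d → ℕ) :=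
  (Finset.Nat.antidiagonalTuple d n).filter fun j => ∀ i, 1 ≤ j i

lemma mem_compositions {d n : ℕ} {j : Fin d → ℕ} :
    j ∈ compositions d n ↔ ∑ i, j i = n ∧ ∀ i, 1 ≤ j i := by
  rw [compositions, mem_filter, Finset.Nat.mem_antidiagonalTuple]

lemma sum_compositions_succ {M : Type*} [AddCommMonoid M] (d n : ℕ) (G : (Fin (d + 1) → ℕ) → M) :
    ∑ j ∈ compositions (d + 1) n, G j =
      ∑ z ∈ antidiagonal n, if z.1 = 0 then 0 else ∑ j ∈ compositions d z.2, G (Fin.cons z.1 j) := by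
  have h : ∀ z ∈ antidiagonal n,
      (if z.1 = 0 then 0 else ∑ j ∈ compositions d z.2, G (Fin.cons z.1 j)) =
        ∑ j ∈ if z.1 = 0 then ∅ else compositions d z.2, G (Fin.cons z.1 j) := fun z _ => by
    split_ifs <;> simp
  rw [Finset.sum_congr rfl h, Finset.sum_sigma']
  refine Finset.sum_nbij' (fun j => ⟨(j 0, ∑ i, Fin.tail j i), Fin.tail j⟩)
    (fun s => Fin.cons s.1.1 s.2) ?_ ?_ ?_ ?_ ?_
  · intro j hj
    obtain ⟨h1, h2⟩ := mem_compositions.1 hj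
    have h0 : j 0 ≠ 0 := (Nat.one_le_iff_ne_zero).1 (h2 0)
    simp only [mem_sigma, HasAntidiagonal.mem_antidiagonal, if_neg h0, mem_compositions]
    exact ⟨by rw [← h1, Fin.sum_univ_succ]; rfl, trivial, fun i => h2 i.succ⟩
  · rintro ⟨⟨a, b⟩, j⟩ hs
    simp only [mem_sigma, HasAntidiagonal.mem_antidiagonal] at hs
    obtain ⟨h1, h2⟩ := hs
    split_ifs at h2 with ha
    · simp at h2
    rw [mem_compositions] at h2 ⊢
    refine ⟨by simp [Fin.sum_univ_succ, h2.1, h1], fun i => ?_⟩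
    induction i using Fin.cases with
    | zero => simpa using Nat.one_le_iff_ne_zero.2 ha
    | succ i => simpa using h2.2 i
  · intro j _
    exact Fin.cons_self_tail j
  · rintro ⟨⟨a, b⟩, j⟩ hs
    simp only [mem_sigma, HasAntidiagonal.mem_antidiagonal] at hs
    obtain ⟨h1, h2⟩ := hs
    split_ifs at h2 with ha
    · simp at h2
    rw [mem_compositions] at h2
    simp [h2.1]
  · intro j _
    simp [Fin.cons_self_tail]

lemma coeff_esymmSeries (N d n : ℕ) :
    PowerSeries.coeff n (esymmSeries N d) =
      ∑ j ∈ compositions d n, ∑ f ∈ strictAntiBox N d, ∏ i, oddInvSq (f i) ^ j i := by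
  induction N generalizing d n with
  | zero =>
    cases d with
    | zero =>
      have hb : strictAntiBox 0 0 = {![]} := by
        ext f
        simp [mem_strictAntiBox, Subsingleton.elim f ![], Subsingleton.strictAnti]
      cases n <;> simp [esymmSeries, compositions, hb, PowerSeries.coeff_one]
    | succ d =>
      have hb : strictAntiBox 0 (d + 1) = ∅ := by
        ext f
        simp [mem_strictAntiBox]
      simp [esymmSeries, hb]
  | succ N ih =>
    cases d with
    | zero =>
      have hb : strictAntiBox (N + 1) 0 = {![]} := by
        ext f
        simp [mem_strictAntiBox, Subsingleton.elim f ![], Subsingleton.strictAnti]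
      cases n <;> simp [esymmSeries, compositions, hb, PowerSeries.coeff_one]
    | succ d =>
      simp_rw [esymmSeries, map_add, sum_strictAntiBox_succ, Finset.sum_add_distrib, ih]
      congr 1
      rw [sum_compositions_succ, PowerSeries.coeff_mul]
      refine Finset.sum_congr rfl fun z _ => ?_
      rw [ih, geomSeries, PowerSeries.coeff_mk]
      split_ifs
      · simp
      · simp_rw [Fin.prod_univ_succ, Fin.cons_zero, Fin.cons_succ, Finset.mul_sum]

lemma sum_strictAntiBox_le {d : ℕ} {j : Fin d → ℕ} (hj : ∀ i, 1 ≤ j i) (N : ℕ) :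
    ∑ f ∈ strictAntiBox N d, ∏ i, oddInvSq (f i) ^ j i ≤ (∑' k, oddInvSq k) ^ d := by
  have hprod := Finset.prod_univ_sum (fun _ : Fin d => range N)
    (fun i k => oddInvSq k ^ j i)
  have hle : ∑ f ∈ strictAntiBox N d, ∏ i, oddInvSq (f i) ^ j i ≤
      ∑ f ∈ Fintype.piFinset fun _ : Fin d => range N, ∏ i, oddInvSq (f i) ^ j i := by
    refine Finset.sum_le_sum_of_subset_of_nonneg (fun f hf => ?_) fun f _ _ =>
      Finset.prod_nonneg fun i _ => pow_nonneg (oddInvSq_pos _).le _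
    simpa using (mem_strictAntiBox.1 hf).1
  refine hle.trans (hprod.symm.le.trans ?_)
  calc ∏ i : Fin d, ∑ k ∈ range N, oddInvSq k ^ j i
      ≤ ∏ _i : Fin d, ∑' k, oddInvSq k := by
        refine Finset.prod_le_prod
          (fun i _ => Finset.sum_nonneg fun k _ => pow_nonneg (oddInvSq_pos k).le _) fun i _ => ?_
        refine le_trans (Finset.sum_le_sum fun k _ => ?_)
          (summable_oddInvSq.sum_le_tsum (range N) fun k _ => (oddInvSq_pos k).le)
        exact pow_le_of_le_one (oddInvSq_pos k).le (oddInvSq_le_one k)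
          (Nat.one_le_iff_ne_zero.1 (hj i))
    _ = _ := by simp

lemma tendsto_sum_strictAntiBox {d : ℕ} {j : Fin d → ℕ} (hj : ∀ i, 1 ≤ j i) :
    Tendsto (fun N => ∑ f ∈ strictAntiBox N d, ∏ i, oddInvSq (f i) ^ j i) atTop
      (𝓝 (mtv d fun i => 2 * j i)) := by
  classical
  have htend : Tendsto (fun N => (strictAntiBox N d).subtype StrictAnti) atTop atTop := by
    refine tendsto_atTop_finset_of_monotone (fun M N hMN f hf => ?_) fun f => ?_
    · rw [Finset.mem_subtype, mem_strictAntiBox] at hf ⊢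
      exact ⟨fun i => (hf.1 i).trans_le hMN, hf.2⟩
    · refine ⟨∑ i, f.1 i + 1, ?_⟩
      rw [Finset.mem_subtype, mem_strictAntiBox]
      exact ⟨fun i => Nat.lt_succ_of_le
        (Finset.single_le_sum (fun _ _ => Nat.zero_le _) (mem_univ i)), f.2⟩
  have hsum : ∀ N, ∑ f ∈ (strictAntiBox N d).subtype StrictAnti, ∏ i, oddInvSq (f.1 i) ^ j i =
      ∑ f ∈ strictAntiBox N d, ∏ i, oddInvSq (f i) ^ j i := fun N =>
    Finset.sum_subtype_of_mem (fun f : Fin d → ℕ => ∏ i, oddInvSq (f i) ^ j i)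
      fun f hf => (mem_strictAntiBox.1 hf).2
  have hnn : ∀ f : {f : Fin d → ℕ // StrictAnti f}, 0 ≤ ∏ i, oddInvSq (f.1 i) ^ j i := fun f =>
    Finset.prod_nonneg fun i _ => pow_nonneg (oddInvSq_pos _).le _
  have hs : Summable fun f : {f : Fin d → ℕ // StrictAnti f} => ∏ i, oddInvSq (f.1 i) ^ j i := by
    refine summable_of_sum_le (c := (∑' k, oddInvSq k) ^ d) hnn fun u => ?_
    obtain ⟨N, hN⟩ := (htend.eventually_ge_atTop u).exists
    refine (Finset.sum_le_sum_of_subset_of_nonneg hN fun f _ _ => hnn f).trans ?_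
    rw [hsum]
    exact sum_strictAntiBox_le hj N
  have := hs.hasSum.comp htend
  simp only [Function.comp_def, hsum] at this
  simpa only [mtv, oddInvSq_pow] using this

lemma tendsto_coeff_esymmSeries (d n : ℕ) :
    Tendsto (fun N => PowerSeries.coeff n (esymmSeries N d)) atTop (𝓝 (Tsum n d)) := by
  simp_rw [coeff_esymmSeries]
  exact tendsto_finsetSum _ fun j hj => tendsto_sum_strictAntiBox (mem_compositions.1 hj).2

lemma esymmSeries_one (N : ℕ) : esymmSeries N 1 = ∑ k ∈ range N, geomSeries k := by
  induction N with
  | zero => simp [esymmSeries]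
  | succ N ih => rw [esymmSeries, ih, esymmSeries_zero_right, mul_one, Finset.sum_range_succ]

lemma mk_Tsum_one : (PowerSeries.mk fun n => Tsum n 1) = t1Series := by
  ext n
  rw [PowerSeries.coeff_mk]
  refine tendsto_nhds_unique (tendsto_coeff_esymmSeries 1 n) ?_
  simp only [esymmSeries_one, map_sum, geomSeries, t1Series, PowerSeries.coeff_mk]
  split_ifs with hn
  · simp
  · exact (hasSum_t1 (Nat.one_le_iff_ne_zero.2 hn)).tendsto_sum_nat

open PowerSeries in
/-- The recursion in the depth for the generating series of the sums `Tsum n d`. -/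
lemma mk_Tsum_recursion (d : ℕ) :
    ((d + 1 : ℕ) : PowerSeries ℝ) * PowerSeries.mk (fun n => Tsum n (d + 1)) +
        X * d⁄dX ℝ (PowerSeries.mk fun n => Tsum n d) =
      PowerSeries.mk (fun n => Tsum n d) * t1Series +
        (d : PowerSeries ℝ) * PowerSeries.mk fun n => Tsum n d := by
  have hnat : ∀ (c n : ℕ) (F : PowerSeries ℝ), coeff n ((c : PowerSeries ℝ) * F) =
      c * coeff n F := fun c n F => by
    rw [← nsmul_eq_mul, map_nsmul, nsmul_eq_mul]
  have htheta : ∀ (n : ℕ) (F : PowerSeries ℝ), coeff n (X * d⁄dX ℝ F) = n * coeff n F := by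
    intro n F
    cases n with
    | zero => simp
    | succ n => rw [coeff_succ_X_mul, coeff_derivative, mul_comm]; push_cast; rfl
  rw [← mk_Tsum_one]
  ext n
  have h : ∀ N, _ = _ := fun N => congrArg (coeff n) (esymmSeries_recursion N d)
  simp only [map_add, hnat, htheta, coeff_mul, coeff_mk] at h ⊢
  have hl := ((tendsto_coeff_esymmSeries (d + 1) n).const_mul ((d + 1 : ℕ) : ℝ)).add
    ((tendsto_coeff_esymmSeries d n).const_mul (n : ℝ))
  have hr := (tendsto_finsetSum (antidiagonal n) fun z _ =>
    (tendsto_coeff_esymmSeries d z.1).mul (tendsto_coeff_esymmSeries 1 z.2)).add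
      ((tendsto_coeff_esymmSeries d n).const_mul (d : ℝ))
  exact tendsto_nhds_unique (hl.congr h) hr

open PowerSeries in
/-- Sum formula for multiple t-values at even arguments of depth 5. -/
theorem T2n_depth_5 (n : ℕ) (hn : 5 ≤ n) :
    Tsum n 5 = 7 / 128 * t1 n - 3 / 64 * t1 1 * t1 (n - 1) + 1 / 320 * t1 2 * t1 (n - 2) := by
  have h₂ := mk_Tsum_recursion 1
  rw [mk_Tsum_one, Nat.cast_one, one_mul] at h₂
  have h := depth_five_of_recursion (derivative_C (r := t1 1)) t1Series_riccati
    (by exact_mod_cast h₂) (by exact_mod_cast mk_Tsum_recursion 2)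
    (by exact_mod_cast mk_Tsum_recursion 3) (by exact_mod_cast mk_Tsum_recursion 4)
  have hp : t1 1 ^ 2 = 3 / 2 * t1 2 := by
    have := sum_t1_mul_t1 0
    norm_num at this
    linarith
  obtain ⟨m, rfl⟩ : ∃ m, n = m + 3 := ⟨n - 3, by omega⟩
  have hc := congrArg (coeff (m + 3)) h
  have hnum : ∀ (c : ℕ) [c.AtLeastTwo], (OfNat.ofNat c : PowerSeries ℝ) = C (OfNat.ofNat c : ℝ) :=
    fun c _ => (map_ofNat C c).symm
  simp only [hnum, map_add, map_sub, ← map_pow, pow_two X, mul_assoc, coeff_C_mul,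
    coeff_succ_X_mul, coeff_mk, t1Series, coeff_X] at hc
  rw [hp] at hc
  simp at hc
  rw [show m + 3 - 1 = m + 2 by omega, show m + 3 - 2 = m + 1 by omega]
  linarith
end
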